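/- Let y ∈ [0, 2/3]. Then the level set L(y) is finite if and only if the set {x₀ ∈ B : x₀ is leading and y ∈ J(x₀)} of leading balanced dyadic rationals x₀ whose hump projection J(x₀) contains y is finite. -/

import Mathlib

open Set MeasureTheory ENNReal

/-- `phi x` is the distance from `x` to the nearest integer. -/
noncomputable def phi (x : ℝ) : ℝ := |x - (round x : ℤ)|

/-- The Takagi function. -/
noncomputable def T (x : ℝ) : ℝ := ∑' n : ℕ, phi (2 ^ n * x) / 2 ^ n

/-- The `n`-th binary digit of `x` (terminating expansion for dyadic rationals). -/
noncomputable def eps (n : ℕ) (x : ℝ) : ℤ := ⌊2 ^ n * x⌋ - 2 * ⌊2 ^ (n - 1) * x⌋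

/-- `D k x = ∑_{j=1}^k (-1)^{ε_j(x)}`, the excess of 0 digits over 1 digits. -/
noncomputable def D (k : ℕ) (x : ℝ) : ℤ := ∑ j ∈ Finset.Icc 1 k, (1 - 2 * eps j x)

/-- The level set of the Takagi function at level `y`. -/
def L (y : ℝ) : Set ℝ := {x | x ∈ Set.Icc (0:ℝ) 1 ∧ T x = y}

/-- `x` is a balanced dyadic rational of order `m`. -/
def BalancedOfOrder (x : ℝ) (m : ℕ) : Prop :=
  x ∈ Set.Ico (0:ℝ) 1 ∧ (∃ k : ℤ, x = (k : ℝ) / 2 ^ (2 * m)) ∧ D (2 * m) x = 0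

/-- The generation of a balanced dyadic rational of order `m`:
the number of indices `1 ≤ j ≤ 2m` with `D j x = 0`. -/
noncomputable def generation (x : ℝ) (m : ℕ) : ℕ :=
  ((Finset.Icc 1 (2 * m)).filter (fun j => D j x = 0)).card

/-- A balanced dyadic rational of order `m` is leading if `D j x ≥ 0` for all `1 ≤ j ≤ 2m`. -/
def Leading (x : ℝ) (m : ℕ) : Prop := ∀ j ∈ Finset.Icc 1 (2 * m), 0 ≤ D j x

/-- The equivalence relation whose classes are the local level sets. -/
def locSetoid : Setoid ℝ where
  r x x' := ∀ n : ℕ, 1 ≤ n → |D n x| = |D n x'|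
  iseqv := ⟨fun _ _ _ => rfl, fun h n hn => (h n hn).symm,
    fun h g n hn => (h n hn).trans (g n hn)⟩

/-- The set of local level sets contained in `L y`: the image of `L y ∩ [0,1)`
under the quotient map of `locSetoid`. -/
def locClasses (y : ℝ) : Set (Quotient locSetoid) :=
  Quotient.mk locSetoid '' (L y ∩ Set.Ico (0:ℝ) 1)

/-! ### The distance to the nearest integer -/

lemma phi_nonneg (x : ℝ) : 0 ≤ phi x := abs_nonneg _

lemma phi_le_half (x : ℝ) : phi x ≤ 1 / 2 := abs_sub_round x

lemma phi_le_abs_sub (x : ℝ) (n : ℤ) : phi x ≤ |x - n| := round_le x n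

lemma phi_add_int (x : ℝ) (n : ℤ) : phi (x + n) = phi x := by
  simp [phi]

lemma phi_neg (x : ℝ) : phi (-x) = phi x := by
  have key : ∀ z : ℝ, phi (-z) ≤ phi z := fun z => by
    have h := phi_le_abs_sub (-z) (-round z)
    rwa [Int.cast_neg, ← neg_sub', abs_neg] at h
  exact le_antisymm (key x) (by simpa using key (-x))

lemma phi_eq_sub_of_mem_left {x : ℝ} {j : ℤ} (h₁ : j ≤ x) (h₂ : x ≤ j + 1 / 2) :
    phi x = x - j := by
  have hf : Int.fract x = x - j := by
    rw [Int.fract, Int.floor_eq_iff.mpr ⟨h₁, by linarith⟩]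
  rw [phi, abs_sub_round_eq_min, hf, min_eq_left (by linarith)]

lemma phi_eq_sub_of_mem_right {x : ℝ} {j : ℤ} (h₁ : j + 1 / 2 ≤ x) (h₂ : x ≤ j + 1) :
    phi x = j + 1 - x := by
  rw [← phi_neg, phi_eq_sub_of_mem_left (j := -(j + 1))]
  · push_cast; ring
  · push_cast; linarith
  · push_cast; linarith

lemma abs_phi_sub_phi_le (x z : ℝ) : |phi x - phi z| ≤ |x - z| := by
  have key : ∀ u v : ℝ, phi u - phi v ≤ |u - v| := fun u v => by
    have h := phi_le_abs_sub u (round v)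
    have h' := abs_sub_le u v (round v)
    have : phi v = |v - (round v : ℤ)| := rfl
    linarith
  exact abs_le.mpr ⟨by linarith [key z x, abs_sub_comm x z], key x z⟩

lemma continuous_phi : Continuous phi := by
  refine (LipschitzWith.of_dist_le_mul (K := 1) fun x z => ?_).continuous
  simpa [Real.dist_eq] using abs_phi_sub_phi_le x z

lemma phi_add_half_phi_two_mul_le (x : ℝ) : phi x + phi (2 * x) / 2 ≤ 1 / 2 := by
  have h := abs_sub_round x
  have hp : phi x = |x - (round x : ℤ)| := rfl
  rcases abs_cases (x - (round x : ℤ)) with ⟨h₁, h₂⟩ | ⟨h₁, h₂⟩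
  · have h₃ := phi_le_abs_sub (2 * x) (2 * round x + 1)
    push_cast at h₃
    rw [abs_of_nonpos (by linarith)] at h₃
    linarith
  · have h₃ := phi_le_abs_sub (2 * x) (2 * round x - 1)
    push_cast at h₃
    rw [abs_of_nonneg (by linarith)] at h₃
    linarith

/-! ### Basic properties of the Takagi function -/

lemma summable_one_div_two_pow : Summable fun n : ℕ => (1 : ℝ) / 2 ^ n := by
  simpa [one_div] using summable_geometric_two

lemma phi_div_two_pow_le (n : ℕ) (x : ℝ) : phi x / 2 ^ n ≤ 1 / 2 ^ n := by
  gcongr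
  linarith [phi_le_half x]

lemma summable_takagi (x : ℝ) : Summable fun n : ℕ => phi (2 ^ n * x) / 2 ^ n :=
  Summable.of_nonneg_of_le (fun n => div_nonneg (phi_nonneg _) (by positivity))
    (fun n => phi_div_two_pow_le n _) summable_one_div_two_pow

lemma T_nonneg (x : ℝ) : 0 ≤ T x :=
  tsum_nonneg fun n => div_nonneg (phi_nonneg _) (by positivity)

lemma T_le_two (x : ℝ) : T x ≤ 2 := by
  have h := (summable_takagi x).tsum_le_tsum (fun n => phi_div_two_pow_le n _)
    summable_one_div_two_pow
  have h2 : ∑' n : ℕ, (1 : ℝ) / 2 ^ n = 2 := by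
    simpa [one_div] using tsum_geometric_two
  exact h.trans h2.le

lemma continuous_T : Continuous T := by
  refine continuous_tsum (fun n => ?_) summable_one_div_two_pow fun n x => ?_
  · exact (continuous_phi.comp (continuous_const.mul continuous_id)).div_const _
  · rw [Real.norm_of_nonneg (div_nonneg (phi_nonneg _) (by positivity))]
    exact phi_div_two_pow_le n _

lemma T_eq_phi_add (x : ℝ) : T x = phi x + T (2 * x) / 2 := by
  rw [T, (summable_takagi x).tsum_eq_zero_add, T, ← tsum_div_const]
  congr 1
  · simp
  · refine tsum_congr fun n => ?_
    rw [div_div, ← pow_succ, ← mul_assoc, ← pow_succ]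

lemma T_neg (x : ℝ) : T (-x) = T x := by
  simp only [T, mul_neg, phi_neg]

lemma T_add_int (x : ℝ) (k : ℤ) : T (x + k) = T x := by
  refine tsum_congr fun n => ?_
  have h : (2 : ℝ) ^ n * (x + k) = 2 ^ n * x + ((2 ^ n * k : ℤ) : ℝ) := by push_cast; ring
  rw [h, phi_add_int]

lemma T_one_sub (x : ℝ) : T (1 - x) = T x := by
  rw [← T_neg x, ← T_add_int (-x) 1]
  congr 1
  push_cast; ring

lemma T_zero : T 0 = 0 := by
  simp [T, phi]

lemma T_intCast (k : ℤ) : T k = 0 := by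
  simpa [T_zero] using T_add_int 0 k

lemma T_one : T 1 = 0 := by
  exact_mod_cast T_intCast 1

lemma T_le (x : ℝ) : T x ≤ 2 / 3 := by
  have key : ∀ n : ℕ, ∀ z : ℝ, T z ≤ 2 / 3 + 2 * (1 / 4) ^ n := by
    intro n
    induction n with
    | zero => intro z; linarith [T_le_two z]
    | succ n ih =>
      intro z
      rw [T_eq_phi_add z, T_eq_phi_add (2 * z), pow_succ]
      linarith [phi_add_half_phi_two_mul_le z, ih (2 * (2 * z))]
  have hlim : Filter.Tendsto (fun n : ℕ => (2 / 3 : ℝ) + 2 * (1 / 4) ^ n) Filter.atTop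
      (nhds (2 / 3 + 2 * 0)) :=
    ((_root_.tendsto_pow_atTop_nhds_zero_of_lt_one (by norm_num) (by norm_num)).const_mul 2).const_add _
  simpa using ge_of_tendsto' hlim fun n => key n x

lemma T_one_third : T (1 / 3) = 2 / 3 := by
  have h₁ := T_eq_phi_add (1 / 3)
  have h₂ : T (2 * (1 / 3)) = T (1 / 3) := by
    rw [← T_one_sub (1 / 3)]; norm_num
  have h₃ : phi (1 / 3) = 1 / 3 := by
    rw [phi_eq_sub_of_mem_left (j := 0)] <;> norm_num
  linarith

lemma exists_T_eq {v : ℝ} (h₀ : 0 ≤ v) (h₁ : v ≤ 2 / 3) : ∃ t ∈ Ico (0 : ℝ) 1, T t = v := by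
  obtain ⟨t, ht, rfl⟩ := intermediate_value_Icc (show (0 : ℝ) ≤ 1 / 3 by norm_num)
    continuous_T.continuousOn (show v ∈ Icc (T 0) (T (1 / 3)) by
      rw [T_zero, T_one_third]; exact ⟨h₀, h₁⟩)
  exact ⟨t, ⟨ht.1, by linarith [ht.2]⟩, rfl⟩

/-! ### Binary digits -/

lemma floor_two_mul_eq_or (x : ℝ) : ⌊2 * x⌋ = 2 * ⌊x⌋ ∨ ⌊2 * x⌋ = 2 * ⌊x⌋ + 1 := by
  have h₁ : 2 * ⌊x⌋ ≤ ⌊2 * x⌋ := Int.le_floor.mpr (by push_cast; linarith [Int.floor_le x])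
  have h₂ : ⌊2 * x⌋ < 2 * ⌊x⌋ + 2 :=
    Int.floor_lt.mpr (by push_cast; linarith [Int.lt_floor_add_one x])
  omega

lemma eps_succ (n : ℕ) (x : ℝ) : eps (n + 1) x = ⌊2 * (2 ^ n * x)⌋ - 2 * ⌊2 ^ n * x⌋ := by
  rw [eps, Nat.add_sub_cancel, pow_succ', mul_assoc]

lemma eps_succ_eq_or (n : ℕ) (x : ℝ) : eps (n + 1) x = 0 ∨ eps (n + 1) x = 1 := by
  rw [eps_succ]
  have := floor_two_mul_eq_or (2 ^ n * x)
  omega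

lemma D_zero (x : ℝ) : D 0 x = 0 := by simp [D]

lemma D_succ (n : ℕ) (x : ℝ) : D (n + 1) x = D n x + (1 - 2 * eps (n + 1) x) := by
  rw [D, Finset.sum_Icc_succ_top (by omega), D]

lemma D_succ_eq_or (n : ℕ) (x : ℝ) : D (n + 1) x = D n x + 1 ∨ D (n + 1) x = D n x - 1 := by
  rw [D_succ]
  have := eps_succ_eq_or n x
  omega

lemma D_add (n k : ℕ) (x : ℝ) : D (n + k) x = D n x + D k (2 ^ n * x) := by
  induction k with
  | zero => simp [D_zero]
  | succ k ih =>
    rw [← add_assoc, D_succ, D_succ, ih, eps_succ, eps_succ, pow_add]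
    ring_nf

lemma D_one_add (k : ℕ) (x : ℝ) : D (k + 1) x = D 1 x + D k (2 * x) := by
  rw [add_comm, D_add, pow_one]

lemma D_add_int (k : ℕ) (x : ℝ) (c : ℤ) : D k (x + c) = D k x := by
  induction k with
  | zero => simp [D_zero]
  | succ k ih =>
    have h₁ : (2 : ℝ) ^ k * (x + c) = 2 ^ k * x + ((2 ^ k * c : ℤ) : ℝ) := by push_cast; ring
    have h₂ : (2 : ℝ) * (2 ^ k * x + ((2 ^ k * c : ℤ) : ℝ))
        = 2 * (2 ^ k * x) + ((2 * (2 ^ k * c) : ℤ) : ℝ) := by push_cast; ring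
    rw [D_succ, D_succ, ih, eps_succ, eps_succ, h₁, h₂, Int.floor_add_intCast,
      Int.floor_add_intCast]
    ring

lemma D_fract (k : ℕ) (x : ℝ) : D k (Int.fract x) = D k x := by
  conv_rhs => rw [← Int.fract_add_floor x, D_add_int]

lemma D_intCast (k : ℕ) (c : ℤ) : D k c = k := by
  have h : D k 0 = k := by simp [D, eps]
  rw [← h, ← D_add_int k 0 c, zero_add]

lemma D_eq_of_floor_eq {k : ℕ} {x z : ℝ} (h : ⌊2 ^ k * x⌋ = ⌊2 ^ k * z⌋) : D k x = D k z := by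
  induction k with
  | zero => simp [D_zero]
  | succ k ih =>
    rw [pow_succ', mul_assoc, mul_assoc] at h
    have h' : ⌊2 ^ k * x⌋ = ⌊2 ^ k * z⌋ := by
      have h₁ := floor_two_mul_eq_or (2 ^ k * x)
      have h₂ := floor_two_mul_eq_or (2 ^ k * z)
      omega
    rw [D_succ, D_succ, ih h', eps_succ, eps_succ, h, h']

lemma D_one_eq (x : ℝ) : D 1 x = 1 - 2 * (⌊2 * x⌋ - 2 * ⌊x⌋) := by
  simpa [D_zero, eps_succ] using D_succ 0 x

lemma floor_two_pow_mul_div (n : ℕ) (c : ℤ) {t : ℝ} (h₀ : 0 ≤ t) (h₁ : t < 1) :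
    ⌊(2 : ℝ) ^ n * ((c + t) / 2 ^ n)⌋ = c := by
  rw [mul_div_cancel₀ _ (by positivity)]
  exact Int.floor_eq_iff.mpr ⟨by linarith, by linarith⟩

lemma D_add_div (n : ℕ) (c : ℤ) {t : ℝ} (h₀ : 0 ≤ t) (h₁ : t < 1) :
    D n ((c + t) / 2 ^ n) = D n (c / 2 ^ n) := by
  apply D_eq_of_floor_eq
  rw [floor_two_pow_mul_div n c h₀ h₁]
  have := floor_two_pow_mul_div n c le_rfl one_pos
  rw [add_zero] at this
  exact this.symm

lemma floor_add_fract_div (n : ℕ) (x : ℝ) :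
    ((⌊2 ^ n * x⌋ : ℝ) + Int.fract (2 ^ n * x)) / 2 ^ n = x := by
  rw [Int.floor_add_fract, mul_div_cancel_left₀ _ (by positivity)]

lemma D_floor_div (n : ℕ) (x : ℝ) : D n (⌊2 ^ n * x⌋ / 2 ^ n) = D n x := by
  rw [← D_add_div n _ (Int.fract_nonneg (2 ^ n * x)) (Int.fract_lt_one _), floor_add_fract_div]

/-! ### Self-affinity of the Takagi function -/

lemma phi_add_div_sub (n : ℕ) (c : ℤ) {t : ℝ} (h₀ : 0 ≤ t) (h₁ : t ≤ 1) :
    phi ((c + t) / 2 ^ (n + 1)) =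
      phi (c / 2 ^ (n + 1)) + D 1 (c / 2 ^ (n + 1)) * t / 2 ^ (n + 1) := by
  set x : ℝ := c / 2 ^ (n + 1) with hx
  have hp : (0 : ℝ) < 2 ^ (n + 1) := by positivity
  have hxt : (c + t) / 2 ^ (n + 1) = x + t / 2 ^ (n + 1) := by rw [hx]; ring
  have ht : 0 ≤ t / 2 ^ (n + 1) := by positivity
  have hub : 2 * (x + t / 2 ^ (n + 1)) ≤ ⌊2 * x⌋ + 1 := by
    have h2x : 2 * x = c / 2 ^ n := by rw [hx, pow_succ]; field_simp
    have hlt : 2 * x < (⌊2 * x⌋ + 1 : ℤ) := by push_cast; exact Int.lt_floor_add_one _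
    rw [h2x, div_lt_iff₀ (by positivity)] at hlt
    have hle : c + 1 ≤ (⌊(c : ℝ) / 2 ^ n⌋ + 1) * 2 ^ n := by exact_mod_cast hlt
    have hle' : (c : ℝ) + 1 ≤ (⌊(c : ℝ) / 2 ^ n⌋ + 1) * 2 ^ n := by exact_mod_cast hle
    have : 2 * (x + t / 2 ^ (n + 1)) = (c + t) / 2 ^ n := by
      rw [hx, pow_succ]; field_simp
    rw [this, h2x, div_le_iff₀ (by positivity)]
    linarith
  have hlb := Int.floor_le (2 * x)
  rw [hxt, D_one_eq]
  rcases floor_two_mul_eq_or x with h | h <;> rw [h] at hub hlb ⊢ <;> push_cast at hub hlb ⊢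
  · rw [phi_eq_sub_of_mem_left (j := ⌊x⌋) (by linarith) (by linarith),
      phi_eq_sub_of_mem_left (j := ⌊x⌋) (by linarith) (by linarith)]
    ring
  · rw [phi_eq_sub_of_mem_right (j := ⌊x⌋) (by linarith) (by linarith),
      phi_eq_sub_of_mem_right (j := ⌊x⌋) (by linarith) (by linarith)]
    ring

/-- On a dyadic interval of length `2⁻ⁿ` the graph of `T` is an affine image of the full graph. -/
lemma T_add_div (n : ℕ) (c : ℤ) {t : ℝ} (h₀ : 0 ≤ t) (h₁ : t ≤ 1) :
    T ((c + t) / 2 ^ n) = T (c / 2 ^ n) + (T t + D n (c / 2 ^ n) * t) / 2 ^ n := by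
  induction n with
  | zero =>
    simp only [pow_zero, div_one, D_zero, T_intCast]
    rw [add_comm, T_add_int]
    simp
  | succ n ih =>
    have h : ∀ z : ℝ, 2 * (z / 2 ^ (n + 1)) = z / 2 ^ n := fun z => by
      rw [pow_succ]; field_simp
    rw [T_eq_phi_add, phi_add_div_sub n c h₀ h₁, T_eq_phi_add (c / 2 ^ (n + 1)), D_one_add n,
      h, h, ih, pow_succ]
    push_cast
    ring

lemma T_eq_floor_add_fract (n : ℕ) (x : ℝ) :
    T x = T (⌊2 ^ n * x⌋ / 2 ^ n) +
      (T (Int.fract (2 ^ n * x)) + D n x * Int.fract (2 ^ n * x)) / 2 ^ n := by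
  have h := T_add_div n ⌊2 ^ n * x⌋ (Int.fract_nonneg (2 ^ n * x)) (Int.fract_lt_one _).le
  rwa [floor_add_fract_div, D_floor_div] at h

lemma T_succ_div (n : ℕ) (c : ℤ) :
    T ((c + 1) / 2 ^ n) = T (c / 2 ^ n) + D n (c / 2 ^ n) / 2 ^ n := by
  simpa [T_one] using T_add_div n c zero_le_one le_rfl

lemma D_reflect_div (n : ℕ) (c : ℤ) : D n ((-1 - c : ℝ) / 2 ^ n) = -D n (c / 2 ^ n) := by
  have h₁ := T_succ_div n (-1 - c)
  have h₂ := T_succ_div n c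
  have h₃ : T (((-1 - c : ℤ) + 1) / 2 ^ n) = T (c / 2 ^ n) := by
    rw [← T_neg]; congr 1; push_cast; ring
  have h₄ : T ((-1 - c : ℤ) / 2 ^ n) = T ((c + 1) / 2 ^ n) := by
    rw [← T_neg]; congr 1; push_cast; ring
  rw [h₃, h₄, h₂] at h₁
  have h₅ : (D n ((-1 - c : ℤ) / 2 ^ n) : ℝ) / 2 ^ n = -D n (c / 2 ^ n) / 2 ^ n := by
    rw [neg_div]; linarith
  rw [div_left_inj' (by positivity)] at h₅
  push_cast at h₅
  exact_mod_cast h₅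

lemma D_fract_two_pow (n k : ℕ) (x : ℝ) :
    D k (Int.fract (2 ^ n * x)) = D (n + k) x - D n x := by
  rw [D_fract, D_add]; ring

/-- A real number whose binary expansion terminates. -/
def IsDyadic (x : ℝ) : Prop := ∃ (n : ℕ) (c : ℤ), 2 ^ n * x = c

lemma IsDyadic.fract_two_pow_mul {x : ℝ} (h : IsDyadic x) (k : ℕ) :
    IsDyadic (Int.fract (2 ^ k * x)) := by
  obtain ⟨n, c, hc⟩ := h
  refine ⟨n, 2 ^ k * c - 2 ^ n * ⌊2 ^ k * x⌋, ?_⟩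
  rw [Int.fract]
  push_cast
  rw [← hc]
  ring

lemma IsDyadic.exists_D_pos {x : ℝ} (h : IsDyadic x) : ∃ k ≥ 1, 0 < D k x := by
  obtain ⟨n, c, hc⟩ := h
  refine ⟨n + ((D n x).natAbs + 1), by omega, ?_⟩
  rw [D_add, hc, D_intCast]
  omega

/-! ### Points whose digit walk stays positive -/

lemma exists_affine_step {s : ℝ} {d : ℤ} (hs : s ∈ Ico (0 : ℝ) 1) (hd : ∀ k, 1 ≤ D k s + d) :
    ∃ d' : ℤ, (∀ k, 1 ≤ D k (Int.fract (2 * s)) + d') ∧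
      (d' - (T (Int.fract (2 * s)) + d' * Int.fract (2 * s))) / 2 ≤ d - (T s + d * s) := by
  have hd0 : (1 : ℝ) ≤ d := by exact_mod_cast (by simpa [D_zero] using hd 0 : 1 ≤ d)
  refine ⟨D 1 s + d, fun k => ?_, ?_⟩
  · have h := hd (k + 1)
    rw [D_one_add] at h
    rw [D_fract]
    linarith
  · have hT := T_eq_floor_add_fract 1 s
    have hsum := Int.floor_add_fract (2 * s)
    have hs0 : ⌊s⌋ = 0 := Int.floor_eq_zero_iff.mpr hs
    have hD := D_one_eq s
    have hhalf : T (1 / 2) = 1 / 2 := by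
      rw [T_eq_phi_add, phi_eq_sub_of_mem_left (j := 0) (by norm_num) (by norm_num)]
      norm_num [T_one]
    rw [pow_one] at hT
    set s' := Int.fract (2 * s)
    rcases floor_two_mul_eq_or s with h | h <;> rw [h, hs0] at hD hT hsum <;>
      norm_num at hD hT hsum <;> rw [hT, hD] <;> push_cast
    · rw [T_zero, show s = s' / 2 by linarith]
      linarith
    · rw [hhalf, show s = (1 + s') / 2 by linarith]
      linarith

lemma T_add_mul_le {s : ℝ} {d : ℤ} (hs : s ∈ Ico (0 : ℝ) 1) (hd : ∀ k, 1 ≤ D k s + d) :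
    T s + d * s ≤ d := by
  have key : ∀ n : ℕ, ∀ s ∈ Ico (0 : ℝ) 1, ∀ d : ℤ, (∀ k, 1 ≤ D k s + d) →
      T s + d * s ≤ d + (1 / 2) ^ n := by
    intro n
    induction n with
    | zero =>
      intro s hs d hd
      have hd0 : (1 : ℝ) ≤ d := by exact_mod_cast (by simpa [D_zero] using hd 0 : 1 ≤ d)
      nlinarith [T_le s, hs.2]
    | succ n ih =>
      intro s hs d hd
      obtain ⟨d', h₁, h₂⟩ := exists_affine_step hs hd
      have h₃ := ih _ ⟨Int.fract_nonneg _, Int.fract_lt_one _⟩ d' h₁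
      rw [pow_succ]
      linarith
  have hlim : Filter.Tendsto (fun n : ℕ => (d : ℝ) + (1 / 2) ^ n) Filter.atTop
      (nhds (d + 0)) :=
    (_root_.tendsto_pow_atTop_nhds_zero_of_lt_one (by norm_num) (by norm_num)).const_add _
  simpa using ge_of_tendsto' hlim fun n => key n s hs d hd

lemma T_add_mul_lt_of_isDyadic {s : ℝ} {d : ℤ} (hs : s ∈ Ico (0 : ℝ) 1)
    (hd : ∀ k, 1 ≤ D k s + d) (hdy : IsDyadic s) : T s + d * s < d := by
  obtain ⟨n, c, hc⟩ := hdy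
  induction n generalizing s d c with
  | zero =>
    have hd0 : (1 : ℝ) ≤ d := by exact_mod_cast (by simpa [D_zero] using hd 0 : 1 ≤ d)
    rw [pow_zero, one_mul] at hc
    have hs0 : ⌊s⌋ = 0 := Int.floor_eq_zero_iff.mpr hs
    rw [hc, Int.floor_intCast] at hs0
    rw [hc, T_intCast, hs0]
    simp only [Int.cast_zero, mul_zero, add_zero]
    linarith
  | succ n ih =>
    obtain ⟨d', h₁, h₂⟩ := exists_affine_step hs hd
    have h₃ := ih ⟨Int.fract_nonneg _, Int.fract_lt_one _⟩ h₁ (c - 2 ^ n * ⌊2 * s⌋) (by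
      rw [Int.fract]
      push_cast
      rw [← hc, pow_succ]
      ring)
    linarith

lemma exists_first_digit_ne {x x' : ℝ} (hx : x ∈ Ico (0 : ℝ) 1) (hx' : x' ∈ Ico (0 : ℝ) 1)
    (hlt : x < x') : ∃ k : ℕ, ⌊2 ^ k * x⌋ = ⌊2 ^ k * x'⌋ ∧
      ⌊2 ^ (k + 1) * x⌋ = 2 * ⌊2 ^ k * x⌋ ∧ ⌊2 ^ (k + 1) * x'⌋ = 2 * ⌊2 ^ k * x⌋ + 1 := by
  classical
  have hex : ∃ n : ℕ, ⌊(2 : ℝ) ^ n * x⌋ ≠ ⌊2 ^ n * x'⌋ := by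
    obtain ⟨n, hn⟩ := pow_unbounded_of_one_lt (1 / (x' - x)) one_lt_two
    refine ⟨n, fun h => ?_⟩
    rw [div_lt_iff₀ (by linarith)] at hn
    have h₁ := Int.floor_le ((2 : ℝ) ^ n * x)
    have h₂ := Int.lt_floor_add_one ((2 : ℝ) ^ n * x')
    rw [h] at h₁
    linarith
  have hspec := Nat.find_spec hex
  have hmin := fun m => Nat.find_min hex (m := m)
  rcases hk : Nat.find hex with _ | k
  · rw [hk] at hspec
    simp [Int.floor_eq_zero_iff.mpr hx, Int.floor_eq_zero_iff.mpr hx'] at hspec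
  · rw [hk] at hspec hmin
    have heq : ⌊2 ^ k * x⌋ = ⌊2 ^ k * x'⌋ := not_not.mp (hmin k (Nat.lt_succ_self k))
    have hle : ⌊2 ^ (k + 1) * x⌋ ≤ ⌊2 ^ (k + 1) * x'⌋ :=
      Int.floor_le_floor (by gcongr)
    have h₁ := floor_two_mul_eq_or (2 ^ k * x)
    have h₂ := floor_two_mul_eq_or (2 ^ k * x')
    rw [← mul_assoc, ← pow_succ'] at h₁ h₂
    exact ⟨k, heq, by omega, by omega⟩

lemma isDyadic_of_T_eq {x x' : ℝ} (hx : x ∈ Ico (0 : ℝ) 1) (hx' : x' ∈ Ico (0 : ℝ) 1)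
    (hD : ∀ k ≥ 1, 0 < D k x) (hD' : ∀ k ≥ 1, 0 < D k x') (hlt : x < x') (hT : T x = T x') :
    ¬ IsDyadic x ∧ IsDyadic x' := by
  obtain ⟨k, hk, h₁, h₂⟩ := exists_first_digit_ne hx hx' hlt
  set c := ⌊2 ^ k * x⌋
  have hDeq : D k x = D k x' := D_eq_of_floor_eq hk
  have hDx : D (k + 1) x = D k x + 1 := by
    rw [D_succ, eps_succ, ← mul_assoc, ← pow_succ', h₁]; ring
  have hDx' : D (k + 1) x' = D k x - 1 := by
    rw [D_succ, eps_succ, ← mul_assoc, ← pow_succ', h₂, ← hk, hDeq]; ring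
  have e₁ := T_eq_floor_add_fract (k + 1) x
  have e₂ := T_eq_floor_add_fract (k + 1) x'
  have e₃ := T_succ_div (k + 1) (2 * c)
  have hDc := D_floor_div (k + 1) x
  rw [h₁] at e₁ hDc
  rw [h₂] at e₂
  have hcast : ((2 * c + 1 : ℤ) : ℝ) = ((2 * c : ℤ) : ℝ) + 1 := by push_cast; ring
  rw [hcast, e₃, hDc] at e₂
  set s := Int.fract (2 ^ (k + 1) * x) with hs
  set s' := Int.fract (2 ^ (k + 1) * x') with hs'
  have hs0 : s ∈ Ico (0 : ℝ) 1 := ⟨Int.fract_nonneg _, Int.fract_lt_one _⟩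
  have hs'0 : 0 ≤ s' := Int.fract_nonneg _
  have hpos : ∀ j, 1 ≤ D j s + D (k + 1) x := fun j => by
    rw [hs, D_fract_two_pow]
    have := hD (k + 1 + j) (by omega)
    omega
  have hle := T_add_mul_le hs0 hpos
  have hT0 := T_nonneg s'
  have hd : (1 : ℝ) ≤ D (k + 1) x' := by exact_mod_cast hD' (k + 1) (by omega)
  have heq : T s + D (k + 1) x * s = D (k + 1) x + (T s' + D (k + 1) x' * s') := by
    rw [e₁, e₂, add_assoc, ← add_div] at hT
    exact (div_left_inj' (by positivity)).mp (add_left_cancel hT)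
  have hs'z : s' = 0 := by nlinarith
  constructor
  · intro hdy
    have := T_add_mul_lt_of_isDyadic hs0 hpos (hdy.fract_two_pow_mul (k + 1))
    nlinarith
  · refine ⟨k + 1, ⌊2 ^ (k + 1) * x'⌋, ?_⟩
    have := Int.floor_add_fract ((2 : ℝ) ^ (k + 1) * x')
    linarith

lemma finite_level_of_D_pos (v : ℝ) :
    {t : ℝ | t ∈ Ico (0 : ℝ) 1 ∧ T t = v ∧ ∀ k ≥ 1, 0 < D k t}.Finite := by
  set G := {t : ℝ | t ∈ Ico (0 : ℝ) 1 ∧ T t = v ∧ ∀ k ≥ 1, 0 < D k t}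
  have key : ∀ x ∈ G, ∀ x' ∈ G, x < x' → ¬ IsDyadic x ∧ IsDyadic x' :=
    fun x hx x' hx' hlt =>
      isDyadic_of_T_eq hx.1 hx'.1 hx.2.2 hx'.2.2 hlt (hx.2.1.trans hx'.2.1.symm)
  have h₁ : {t ∈ G | IsDyadic t}.Subsingleton := by
    rintro x ⟨hx, hdx⟩ x' ⟨hx', hdx'⟩
    by_contra hne
    rcases lt_or_gt_of_ne hne with h | h
    · exact (key x hx x' hx' h).1 hdx
    · exact (key x' hx' x hx h).1 hdx'
  have h₂ : {t ∈ G | ¬ IsDyadic t}.Subsingleton := by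
    rintro x ⟨hx, hdx⟩ x' ⟨hx', hdx'⟩
    by_contra hne
    rcases lt_or_gt_of_ne hne with h | h
    · exact hdx' (key x hx x' hx' h).2
    · exact hdx (key x' hx' x hx h).2
  refine (h₁.finite.union h₂.finite).subset fun t ht => ?_
  by_cases hd : IsDyadic t
  · exact Or.inl ⟨ht, hd⟩
  · exact Or.inr ⟨ht, hd⟩

lemma D_one_sub_of_not_isDyadic {t : ℝ} (ht : ¬ IsDyadic t) (k : ℕ) :
    D k (1 - t) = -D k t := by
  have hfl : ⌊2 ^ k * -t⌋ = -1 - ⌊2 ^ k * t⌋ := by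
    have h₁ := Int.floor_le ((2 : ℝ) ^ k * t)
    have h₂ := Int.lt_floor_add_one ((2 : ℝ) ^ k * t)
    have h₃ : (2 : ℝ) ^ k * t ≠ ⌊2 ^ k * t⌋ := fun h => ht ⟨k, _, h⟩
    have h₄ := lt_of_le_of_ne h₁ h₃.symm
    rw [Int.floor_eq_iff]
    push_cast
    constructor <;> linarith
  have h : D k (1 - t) = D k (-t) := by
    rw [← D_add_int k (-t) 1]
    congr 1
    push_cast; ring
  rw [h, ← D_floor_div k (-t), hfl, ← D_floor_div k t, ← D_reflect_div]
  push_cast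
  rfl

lemma finite_level_of_D_neg (v : ℝ) :
    {t : ℝ | t ∈ Ico (0 : ℝ) 1 ∧ T t = v ∧ ∀ k ≥ 1, D k t < 0}.Finite := by
  refine ((finite_level_of_D_pos v).image fun t => 1 - t).subset ?_
  rintro t ⟨ht, hT, hD⟩
  have hdy : ¬ IsDyadic t := fun h => by
    obtain ⟨k, hk, hpos⟩ := h.exists_D_pos
    exact absurd (hD k hk) (by omega)
  have ht0 : t ≠ 0 := fun h => hdy ⟨0, 0, by simp [h]⟩
  have ht0' : 0 < t := lt_of_le_of_ne ht.1 ht0.symm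
  refine ⟨1 - t, ⟨⟨by linarith [ht.2], by linarith⟩, by rw [T_one_sub, hT], fun k hk => ?_⟩,
    by ring⟩
  rw [D_one_sub_of_not_isDyadic hdy]
  linarith [hD k hk]

lemma D_pos_or_neg {t : ℝ} (h : ∀ k ≥ 1, D k t ≠ 0) :
    (∀ k ≥ 1, 0 < D k t) ∨ ∀ k ≥ 1, D k t < 0 := by
  rcases lt_or_gt_of_ne (h 1 le_rfl) with h₁ | h₁
  · refine Or.inr fun k hk => ?_
    induction k, hk using Nat.le_induction with
    | base => exact h₁
    | succ k hk ih =>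
      have := D_succ_eq_or k t
      have := h (k + 1) (by omega)
      omega
  · refine Or.inl fun k hk => ?_
    induction k, hk using Nat.le_induction with
    | base => exact h₁
    | succ k hk ih =>
      have := D_succ_eq_or k t
      have := h (k + 1) (by omega)
      omega

lemma finite_level_of_D_ne_zero (v : ℝ) :
    {t : ℝ | t ∈ Ico (0 : ℝ) 1 ∧ T t = v ∧ ∀ k ≥ 1, D k t ≠ 0}.Finite := by
  refine ((finite_level_of_D_pos v).union (finite_level_of_D_neg v)).subset ?_
  rintro t ⟨ht, hT, hD⟩
  rcases D_pos_or_neg hD with h | h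
  · exact Or.inl ⟨ht, hT, h⟩
  · exact Or.inr ⟨ht, hT, h⟩

lemma floor_two_pow_mul_nonneg {x : ℝ} (hx : x ∈ Ico (0 : ℝ) 1) (n : ℕ) :
    0 ≤ ⌊2 ^ n * x⌋ :=
  Int.floor_nonneg.mpr (mul_nonneg (by positivity) hx.1)

lemma floor_two_pow_mul_lt {x : ℝ} (hx : x ∈ Ico (0 : ℝ) 1) (n : ℕ) :
    ⌊2 ^ n * x⌋ < 2 ^ n := by
  rw [Int.floor_lt]
  push_cast
  have : (0 : ℝ) < 2 ^ n := by positivity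
  nlinarith [hx.2]

/-! ### Leading representatives -/

/-- Reflecting the digits after a zero of the digit walk preserves the height of a balanced dyadic
rational and, if the next digit is `1`, makes it smaller. -/
lemma exists_smaller_balanced {n c : ℕ} (hc : c < 2 ^ n) (hD : D n (c / 2 ^ n) = 0)
    {j : ℕ} (hj : j ≤ n) (hneg : D j (c / 2 ^ n) < 0) :
    ∃ c' < c, D n (c' / 2 ^ n) = 0 ∧ T (c' / 2 ^ n) = T (c / 2 ^ n) := by
  classical
  set x : ℝ := c / 2 ^ n with hx
  have hx01 : x ∈ Ico (0 : ℝ) 1 :=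
    ⟨by positivity, (div_lt_one (by positivity)).mpr (by exact_mod_cast hc)⟩
  have hex : ∃ i : ℕ, D i x < 0 := ⟨j, hneg⟩
  have hspec := Nat.find_spec hex
  have hle := Nat.find_le (h := hex) hneg
  have hmin := fun i => Nat.find_min hex (m := i)
  rcases hi : Nat.find hex with _ | a
  · rw [hi, D_zero] at hspec
    exact absurd hspec (lt_irrefl 0)
  rw [hi] at hspec hmin hle
  have hDa : D a x = 0 := by
    have := hmin a (Nat.lt_succ_self a)
    have := D_succ_eq_or a x
    omega
  have hdigit : ⌊2 * (2 ^ a * x)⌋ = 2 * ⌊2 ^ a * x⌋ + 1 := by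
    rw [D_succ, hDa, eps_succ] at hspec
    have := floor_two_mul_eq_or (2 ^ a * x)
    omega
  obtain ⟨b, rfl⟩ : ∃ b, n = a + b := ⟨n - a, by omega⟩
  have hp0 := floor_two_pow_mul_nonneg hx01 a
  have hpt := Int.floor_add_fract (2 ^ a * x)
  have ht1 := Int.fract_lt_one (2 ^ a * x)
  have hDb : D b (Int.fract (2 ^ a * x)) = 0 := by rw [D_fract_two_pow, hD, hDa, sub_zero]
  have hTx := T_eq_floor_add_fract a x
  have hDp := D_floor_div a x
  have hfl := Int.floor_le (2 * (2 ^ a * x))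
  rw [hdigit] at hfl
  set p := ⌊2 ^ a * x⌋
  obtain ⟨r, hr⟩ : ∃ r : ℤ, r = (c : ℤ) - p * 2 ^ b := ⟨_, rfl⟩
  have h2b : (0 : ℝ) < 2 ^ b := by positivity
  have h2a : (0 : ℝ) < 2 ^ a := by positivity
  have hax : 2 ^ a * x = c / 2 ^ b := by rw [hx, pow_add]; field_simp
  have hrR : (r : ℝ) = c - p * 2 ^ b := by rw [hr]; push_cast; ring
  have ht : Int.fract (2 ^ a * x) = r / 2 ^ b := by
    rw [hrR, sub_div, mul_div_cancel_right₀ _ h2b.ne', ← hax]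
    linarith
  rw [ht] at hpt ht1 hDb hTx
  have hr1 : r + 1 ≤ 2 ^ b := by
    rw [div_lt_one h2b] at ht1
    exact_mod_cast ht1
  have hr2 : 2 ^ b ≤ 2 * r := by
    have h : (1 : ℝ) ≤ 2 * (r / 2 ^ b) := by push_cast at hfl; linarith
    rw [← mul_div_assoc, one_le_div h2b] at h
    exact_mod_cast h
  have hpb : 0 ≤ p * 2 ^ b := by positivity
  obtain ⟨c', hc'⟩ : ∃ c' : ℕ, (c' : ℤ) = p * 2 ^ b + (2 ^ b - 1 - r) :=
    ⟨(p * 2 ^ b + (2 ^ b - 1 - r)).toNat, Int.toNat_of_nonneg (by linarith)⟩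
  obtain ⟨t', ht'⟩ : ∃ t' : ℝ, t' = 1 - (r + 1) / 2 ^ b := ⟨_, rfl⟩
  have hr1R : (r : ℝ) + 1 ≤ 2 ^ b := by exact_mod_cast hr1
  have hr2R : (2 : ℝ) ^ b ≤ 2 * r := by exact_mod_cast hr2
  have ht'0 : 0 ≤ t' := by
    rw [ht', sub_nonneg, div_le_one h2b]
    exact hr1R
  have ht'1 : t' < 1 := by
    have : (0 : ℝ) < (r + 1) / 2 ^ b := div_pos (by linarith) h2b
    linarith
  have hcR : (c' : ℝ) = p * 2 ^ b + (2 ^ b - 1 - r) := by exact_mod_cast hc'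
  have hx' : (c' : ℝ) / 2 ^ (a + b) = (p + t') / 2 ^ a := by
    rw [hcR, ht', pow_add]
    field_simp
    ring
  refine ⟨c', by zify; linarith, ?_, ?_⟩
  · have h : (2 : ℝ) ^ a * ((p + t') / 2 ^ a) = (-1 - r) / 2 ^ b + ((p + 1 : ℤ) : ℝ) := by
      rw [mul_div_cancel₀ _ h2a.ne', ht']
      push_cast
      ring
    rw [hx', D_add, D_add_div a p ht'0 ht'1, hDp, hDa, h, D_add_int, D_reflect_div, hDb]
    rfl
  · rw [hx', T_add_div a p ht'0 ht'1.le, hDp, hTx, hDa, ht', T_one_sub, T_succ_div, hDb]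
    simp

lemma exists_leading_of_balanced {n : ℕ} (c : ℕ) (hc : c < 2 ^ n) (hD : D n (c / 2 ^ n) = 0) :
    ∃ c' < 2 ^ n, D n ((c' : ℕ) / 2 ^ n) = 0 ∧ T (c' / 2 ^ n) = T (c / 2 ^ n) ∧
      ∀ j ≤ n, 0 ≤ D j ((c' : ℕ) / 2 ^ n) := by
  induction c using Nat.strong_induction_on with
  | _ c ih =>
    by_cases hlead : ∀ j ≤ n, 0 ≤ D j ((c : ℕ) / 2 ^ n)
    · exact ⟨c, hc, hD, rfl, hlead⟩
    · push Not at hlead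
      obtain ⟨j, hj, hneg⟩ := hlead
      obtain ⟨c₁, hlt, hD₁, hT₁⟩ := exists_smaller_balanced hc hD hj hneg
      obtain ⟨c', h₁, h₂, h₃, h₄⟩ := ih c₁ hlt (hlt.trans hc) hD₁
      exact ⟨c', h₁, h₂, h₃.trans hT₁, h₄⟩

/-! ### Finite level sets meet finitely many humps -/

lemma exists_mem_hump {x₀ y : ℝ} {m : ℕ} (hbal : BalancedOfOrder x₀ m) (h₀ : T x₀ ≤ y)
    (h₁ : y ≤ T x₀ + (2 / 3) * (1 : ℝ) / 4 ^ m) :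
    ∃ x ∈ Ico (0 : ℝ) 1, T x = y ∧ D (2 * m) x = 0 ∧
      (⌊2 ^ (2 * m) * x⌋ : ℝ) / 2 ^ (2 * m) = x₀ := by
  obtain ⟨hx₀, ⟨k, hk⟩, hD⟩ := hbal
  have h4 : (4 : ℝ) ^ m = 2 ^ (2 * m) := by rw [pow_mul]; norm_num
  rw [h4] at h₁
  have hpos : (0 : ℝ) < 2 ^ (2 * m) := by positivity
  obtain ⟨t, ht, hTt⟩ := exists_T_eq (v := (y - T x₀) * 2 ^ (2 * m))
    (mul_nonneg (by linarith) hpos.le) (by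
      rw [← le_div_iff₀ hpos]
      linarith)
  have hkn : k + 1 ≤ 2 ^ (2 * m) := by
    have h := hx₀.2
    rw [hk, div_lt_one hpos] at h
    exact_mod_cast h
  have hkn' : (k : ℝ) + 1 ≤ 2 ^ (2 * m) := by exact_mod_cast hkn
  have hk0 : (0 : ℝ) ≤ k := by
    have h := hx₀.1
    rw [hk] at h
    simpa [zero_mul] using (le_div_iff₀ hpos).mp h
  refine ⟨(k + t) / 2 ^ (2 * m), ⟨div_nonneg (by linarith [ht.1]) hpos.le, ?_⟩, ?_, ?_, ?_⟩
  · rw [div_lt_one hpos]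
    linarith [ht.2]
  · rw [T_add_div _ k ht.1 ht.2.le, ← hk, hD, hTt]
    field_simp
    push_cast
    ring
  · rw [D_add_div _ k ht.1 ht.2, ← hk, hD]
  · rw [floor_two_pow_mul_div _ k ht.1 ht.2, hk]

/-- If the digit walk of `x` returns to zero infinitely often, reflecting `x` inside each of the
corresponding humps yields infinitely many points of the same height. -/
lemma infinite_level_of_infinite_zeros {x : ℝ} (hx : x ∈ Ico (0 : ℝ) 1)
    (h : {m : ℕ | D (2 * m) x = 0}.Infinite) : (L (T x)).Infinite := by
  refine Set.infinite_of_injOn_mapsTo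
    (f := fun m : ℕ => (2 * ⌊2 ^ (2 * m) * x⌋ + 1 : ℝ) / 2 ^ (2 * m) - x) ?_ ?_ h
  · have key : ∀ m k : ℕ, (2 * ⌊2 ^ (2 * m) * x⌋ + 1 : ℝ) / 2 ^ (2 * m) ≠
        (2 * ⌊2 ^ (2 * (m + k + 1)) * x⌋ + 1 : ℝ) / 2 ^ (2 * (m + k + 1)) := by
      intro m k he
      generalize ⌊2 ^ (2 * m) * x⌋ = c at he
      generalize ⌊2 ^ (2 * (m + k + 1)) * x⌋ = c' at he
      have hpow : (2 : ℝ) ^ (2 * (m + k + 1)) = 2 ^ (2 * m) * (2 * 2 ^ (2 * k + 1)) := by ring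
      rw [hpow, ← div_div, div_right_comm, div_left_inj' (by positivity),
        _root_.eq_div_iff (by positivity)] at he
      have he' : (2 * c + 1) * (2 * 2 ^ (2 * k + 1)) = 2 * c' + 1 := by exact_mod_cast he
      rw [mul_left_comm] at he'
      omega
    intro m _ m' _ he
    have he' := sub_left_injective he
    rcases lt_trichotomy m m' with hlt | heq | hlt
    · obtain ⟨k, rfl⟩ := Nat.exists_eq_add_of_lt hlt
      exact absurd he' (key m k)
    · exact heq
    · obtain ⟨k, rfl⟩ := Nat.exists_eq_add_of_lt hlt
      exact absurd he'.symm (key m' k)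
  · intro m hm
    have hm' : D (2 * m) x = 0 := hm
    have hpos : (0 : ℝ) < 2 ^ (2 * m) := by positivity
    have hT := T_eq_floor_add_fract (2 * m) x
    have ht0 := Int.fract_nonneg (2 ^ (2 * m) * x)
    have ht1 := (Int.fract_lt_one (2 ^ (2 * m) * x)).le
    have hDc := D_floor_div (2 * m) x
    have hc0 : (0 : ℝ) ≤ ⌊2 ^ (2 * m) * x⌋ := by
      exact_mod_cast floor_two_pow_mul_nonneg hx (2 * m)
    have hc1 : (⌊2 ^ (2 * m) * x⌋ : ℝ) + 1 ≤ 2 ^ (2 * m) := by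
      exact_mod_cast floor_two_pow_mul_lt hx (2 * m)
    have hxe := floor_add_fract_div (2 * m) x
    set t := Int.fract (2 ^ (2 * m) * x)
    set c := ⌊2 ^ (2 * m) * x⌋
    have he : (2 * c + 1 : ℝ) / 2 ^ (2 * m) - x = (c + (1 - t)) / 2 ^ (2 * m) := by
      conv_lhs => rw [← hxe]
      rw [← sub_div]
      ring
    change (2 * c + 1 : ℝ) / 2 ^ (2 * m) - x ∈ L (T x)
    rw [he]
    refine ⟨⟨div_nonneg (by linarith) hpos.le, (div_le_one hpos).mpr (by linarith)⟩, ?_⟩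
    rw [T_add_div _ c (by linarith) (by linarith), hDc, hT, hm', T_one_sub]
    simp

lemma finite_zeros_of_finite_level {x y : ℝ} (hL : (L y).Finite) :
    {m : ℕ | (x ∈ Ico (0 : ℝ) 1 ∧ T x = y) ∧ D (2 * m) x = 0}.Finite := by
  by_cases hx : x ∈ Ico (0 : ℝ) 1 ∧ T x = y
  · obtain ⟨hx, rfl⟩ := hx
    by_contra hinf
    refine infinite_level_of_infinite_zeros hx (Set.Infinite.mono ?_ hinf) hL
    exact fun m hm => hm.2
  · exact Set.finite_empty.subset fun m hm => absurd hm.1 hx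

/-! ### Finitely many leading humps force a finite level set -/

lemma BalancedOfOrder.order_le {x : ℝ} {m m' : ℕ} (h : BalancedOfOrder x m)
    (h' : BalancedOfOrder x m') : m' ≤ m := by
  obtain ⟨-, ⟨k, hk⟩, hD⟩ := h
  by_contra hlt
  obtain ⟨r, rfl⟩ := Nat.exists_eq_add_of_lt (not_le.mp hlt)
  have hk' : (2 : ℝ) ^ (2 * m) * x = k := by
    rw [hk, mul_div_cancel₀ _ (by positivity)]
  have h := h'.2.2
  rw [show 2 * (m + r + 1) = 2 * m + (2 * r + 2) by ring, D_add, hD, hk', D_intCast] at h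
  push_cast at h
  omega

lemma finite_orders {P : ℝ → ℕ → Prop}
    (hS : {x₀ : ℝ | ∃ m : ℕ, BalancedOfOrder x₀ m ∧ P x₀ m}.Finite) :
    {m : ℕ | ∃ x₀ : ℝ, BalancedOfOrder x₀ m ∧ P x₀ m}.Finite := by
  refine (hS.biUnion (t := fun x₀ => {m : ℕ | BalancedOfOrder x₀ m}) fun x₀ _ =>
    Set.Subsingleton.finite fun m hm m' hm' =>
      le_antisymm (hm'.order_le hm) (hm.order_le hm')).subset ?_
  rintro m ⟨x₀, hb, hP⟩
  exact mem_biUnion (x := x₀) ⟨m, hb, hP⟩ hb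

lemma exists_leading_hump {x : ℝ} (hx : x ∈ Ico (0 : ℝ) 1) {m : ℕ} (hD : D (2 * m) x = 0) :
    ∃ x₀ : ℝ, BalancedOfOrder x₀ m ∧ Leading x₀ m ∧
      T x ∈ Icc (T x₀) (T x₀ + (2 / 3) * (1 : ℝ) / 4 ^ m) := by
  have hT := T_eq_floor_add_fract (2 * m) x
  have hDc := D_floor_div (2 * m) x
  have hc1 := floor_two_pow_mul_lt hx (2 * m)
  obtain ⟨c, hc⟩ := Int.eq_ofNat_of_zero_le (floor_two_pow_mul_nonneg hx (2 * m))
  rw [hc] at hT hDc hc1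
  simp only [Int.cast_natCast] at hT hDc hc1
  rw [hD] at hT hDc
  obtain ⟨c', h₁, h₂, h₃, h₄⟩ := exists_leading_of_balanced c (by exact_mod_cast hc1) hDc
  have h4 : (4 : ℝ) ^ m = 2 ^ (2 * m) := by rw [pow_mul]; norm_num
  have hpos : (0 : ℝ) < 2 ^ (2 * m) := by positivity
  refine ⟨c' / 2 ^ (2 * m), ⟨⟨by positivity, ?_⟩, ⟨c', by simp⟩, h₂⟩, fun j hj => ?_, ?_, ?_⟩
  · rw [div_lt_one hpos]
    exact_mod_cast h₁
  · exact h₄ j (Finset.mem_Icc.mp hj).2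
  · rw [h₃, hT]
    have := T_nonneg (Int.fract (2 ^ (2 * m) * x))
    simp only [Int.cast_zero, zero_mul, add_zero, le_add_iff_nonneg_right]
    positivity
  · rw [h₃, hT, h4]
    simp only [Int.cast_zero, zero_mul, add_zero, mul_one]
    gcongr
    exact T_le _

lemma even_of_D_eq_zero {n : ℕ} {x : ℝ} (h : D n x = 0) : ∃ m, n = 2 * m := by
  have key : ∀ k : ℕ, ∃ q : ℤ, D k x = k + 2 * q := by
    intro k
    induction k with
    | zero => exact ⟨0, by simp [D_zero]⟩
    | succ k ih =>
      obtain ⟨q, hq⟩ := ih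
      exact ⟨q - eps (k + 1) x, by rw [D_succ, hq]; push_cast; ring⟩
  obtain ⟨q, hq⟩ := key n
  exact ⟨n / 2, by omega⟩

lemma finite_level_of_finite_orders {y : ℝ}
    (hM : {m : ℕ | ∃ x₀ : ℝ, BalancedOfOrder x₀ m ∧ Leading x₀ m ∧
      y ∈ Icc (T x₀) (T x₀ + (2 / 3) * (1 : ℝ) / 4 ^ m)}.Finite) : (L y).Finite := by
  set M := {m : ℕ | ∃ x₀ : ℝ, BalancedOfOrder x₀ m ∧ Leading x₀ m ∧
      y ∈ Icc (T x₀) (T x₀ + (2 / 3) * (1 : ℝ) / 4 ^ m)}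
  let G : ℕ → ℤ → Set ℝ := fun m c => {t : ℝ | t ∈ Ico (0 : ℝ) 1 ∧
    T t = (y - T (c / 2 ^ (2 * m))) * 2 ^ (2 * m) ∧ ∀ k ≥ 1, D k t ≠ 0}
  have hfin : (⋃ m ∈ M, ⋃ c ∈ Ico (0 : ℤ) (2 ^ (2 * m)),
      (fun t : ℝ => (c + t) / 2 ^ (2 * m)) '' G m c).Finite :=
    hM.biUnion fun m _ => (Set.finite_Ico _ _).biUnion fun c _ =>
      (finite_level_of_D_ne_zero _).image _
  refine (hfin.union (Set.finite_singleton 1)).subset ?_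
  rintro x ⟨⟨hx0, hx1⟩, hTx⟩
  rcases hx1.eq_or_lt with rfl | hx1
  · exact Or.inr rfl
  left
  have hx : x ∈ Ico (0 : ℝ) 1 := ⟨hx0, hx1⟩
  have hZM : {m : ℕ | D (2 * m) x = 0} ⊆ M := fun m hm => by
    have := exists_leading_hump hx hm
    rwa [hTx] at this
  obtain ⟨m, hm, hmax⟩ := (hM.subset hZM).exists_maximal ⟨0, by simp [D_zero]⟩
  have hm' : D (2 * m) x = 0 := hm
  have hT := T_eq_floor_add_fract (2 * m) x
  refine mem_biUnion (hZM hm) (mem_biUnion (x := ⌊2 ^ (2 * m) * x⌋)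
    ⟨floor_two_pow_mul_nonneg hx _, floor_two_pow_mul_lt hx _⟩
    ⟨Int.fract (2 ^ (2 * m) * x), ⟨⟨Int.fract_nonneg _, Int.fract_lt_one _⟩, ?_, ?_⟩,
      floor_add_fract_div _ _⟩)
  · rw [← hTx]
    conv_rhs => rw [hT]
    rw [hm']
    simp
  · intro k hk hDk
    rw [D_fract_two_pow, hm', sub_zero] at hDk
    obtain ⟨m', hm''⟩ := even_of_D_eq_zero hDk
    rw [hm''] at hDk
    have := hmax hDk (by omega)
    omega

theorem stmt4 (y : ℝ) (hy : y ∈ Set.Icc (0:ℝ) (2/3)) :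
    (L y).Finite ↔
      {x₀ : ℝ | ∃ m : ℕ, BalancedOfOrder x₀ m ∧ Leading x₀ m ∧
        y ∈ Set.Icc (T x₀) (T x₀ + (2/3) * (1:ℝ) / 4 ^ m)}.Finite := by
  constructor
  · intro hL
    refine (hL.biUnion fun x _ => ((finite_zeros_of_finite_level (x := x) hL).image
      fun m => (⌊2 ^ (2 * m) * x⌋ : ℝ) / 2 ^ (2 * m))).subset ?_
    rintro x₀ ⟨m, hbal, -, hy₀, hy₁⟩
    obtain ⟨x, hx, hTx, hD, rfl⟩ := exists_mem_hump hbal hy₀ hy₁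
    exact mem_biUnion (x := x) ⟨⟨hx.1, hx.2.le⟩, hTx⟩ ⟨m, ⟨⟨hx, hTx⟩, hD⟩, rfl⟩
  · intro hS
    exact finite_level_of_finite_orders (finite_orders hS)
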